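/- arXiv:0911.1737 — 2 statements merged into one kernel-verified Lean document; each statement's English description precedes it below -/
import Mathlib

section
/- Let R be a commutative ring, x, y ∈ R, and n a positive integer. For every positive integer k, the n×n determinant det_{0≤i,j≤n−1}(P_{i+j}(0,k)) equals (−1)^{kn₁+C(k,2)}·(xy)^{k(n₁−1)(2kn₁−k+1)} if n = 2kn₁−k+1 for a positive integer n₁; it equals (−1)^{kn₁}·(xy)^{kn₁(2kn₁−k−1)} if n = 2kn₁ for a positive integer n₁; and it equals 0 if n is congruent to neither 0 nor k+1 modulo 2k. For k = 0, det_{0≤i,j≤n−1}(P_{i+j}(0,0)) = 2^{n−1}·(xy)^{C(n,2)}. -/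
/-- `pgf x y n k` is the generating function `P_n(0,k)` of lattice paths from `(0,0)` to
`(n,k)` with steps `(1,1)`, `(1,0)`, `(1,-1)`, weighted `1`, `x+y`, `xy` respectively:
`P_n(0,k) = Σ_ℓ C(n,ℓ)·C(n,n−k−ℓ)·x^ℓ·y^{n−k−ℓ}`, the sum over integers `ℓ ≥ 0` with
`n−k−ℓ ≥ 0` (terms with `ℓ > n` vanish since then `C(n,ℓ) = 0`). -/
def pgf {R : Type*} [CommRing R] (x y : R) (n : ℕ) (k : ℤ) : R :=
  ∑ ℓ ∈ Finset.range (n + 1),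
    if (ℓ : ℤ) ≤ (n : ℤ) - k then
      (n.choose ℓ : R) * (n.choose ((n : ℤ) - k - ℓ).toNat : R) *
        x ^ ℓ * y ^ ((n : ℤ) - k - ℓ).toNat
    else 0

section Functional

open Polynomial

variable {R : Type*} [CommRing R]

theorem pgf_eq_coeff (x y : R) (n : ℕ) (k : ℤ) :
    pgf x y n k = if k ≤ n then
      ((1 + C x * X) ^ n * (1 + C y * X) ^ n : R[X]).coeff ((n : ℤ) - k).toNat else 0 := by
  have hc (z : R) (m : ℕ) : ((1 + C z * X : R[X]) ^ n).coeff m = n.choose m * z ^ m := by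
    have : (1 + C z * X : R[X]) ^ n = ((1 + X) ^ n : R[X]).comp (C z * X) := by simp
    rw [this, comp_C_mul_X_coeff, coeff_one_add_X_pow]
  unfold pgf
  split_ifs with h
  · obtain ⟨d, hd⟩ := Int.eq_ofNat_of_zero_le (sub_nonneg.2 h)
    simp only [hd, Int.toNat_natCast, coeff_mul, hc]
    rw [Finset.Nat.sum_antidiagonal_eq_sum_range_succ_mk]
    trans ∑ ℓ ∈ Finset.range (n + d + 1), if ℓ ≤ d then
        (n.choose ℓ : R) * (n.choose (d - ℓ) : R) * x ^ ℓ * y ^ (d - ℓ) else 0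
    · have hs : Finset.range (n + 1) ⊆ Finset.range (n + d + 1) := by
        simp only [Finset.range_subset_range]; omega
      rw [← Finset.sum_subset hs]
      · refine Finset.sum_congr rfl fun ℓ _ => ?_
        have : ((d : ℤ) - ℓ).toNat = d - ℓ := by omega
        simp [this]
      · intro ℓ _ hℓ
        rw [Finset.mem_range, not_lt] at hℓ
        simp [Nat.choose_eq_zero_of_lt (show n < ℓ by omega)]
    · have hs : Finset.range (d + 1) ⊆ Finset.range (n + d + 1) := by
        simp only [Finset.range_subset_range]; omega
      rw [← Finset.sum_subset hs]
      · refine Finset.sum_congr rfl fun ℓ hℓ => ?_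
        rw [Finset.mem_range] at hℓ
        rw [if_pos (by omega)]
        ring
      · intro ℓ _ hℓ
        rw [Finset.mem_range, not_lt] at hℓ
        rw [if_neg (by omega)]
  · refine Finset.sum_eq_zero fun ℓ _ => if_neg (by omega)

theorem pgf_zero (x y : R) (k : ℤ) : pgf x y 0 k = if k = 0 then 1 else 0 := by
  rw [pgf_eq_coeff]
  simp only [pow_zero, mul_one, coeff_one]
  split_ifs <;> first | rfl | omega

theorem pgf_succ (x y : R) (n : ℕ) (k : ℤ) :
    pgf x y (n + 1) k =
      pgf x y n (k - 1) + (x + y) * pgf x y n k + x * y * pgf x y n (k + 1) := by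
  simp only [pgf_eq_coeff]
  set G : R[X] := (1 + C x * X) ^ n * (1 + C y * X) ^ n with hG
  have h : (1 + C x * X) ^ (n + 1) * (1 + C y * X) ^ (n + 1) =
      G + C (x + y) * (X * G) + C (x * y) * (X * (X * G)) := by
    rw [hG, C_add, C_mul]; ring
  rw [h]
  simp only [coeff_add, coeff_C_mul]
  by_cases h1 : (n : ℤ) + 1 < k
  · rw [if_neg (by push_cast; omega), if_neg (by omega), if_neg (by omega), if_neg (by omega)]
    simp
  obtain ⟨d, hd⟩ := Int.eq_ofNat_of_zero_le (show 0 ≤ (n : ℤ) + 1 - k by omega)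
  obtain rfl : k = n + 1 - d := by omega
  match d with
  | 0 => simp
  | 1 => simp
  | d + 2 =>
    rw [if_pos (by push_cast; omega), if_pos (by omega), if_pos (by push_cast; omega),
      if_pos (by push_cast; omega)]
    rw [show (((n + 1 : ℕ) : ℤ) - (n + 1 - (d + 2 : ℕ))).toNat = d + 1 + 1 by omega,
      show ((n : ℤ) - (n + 1 - (d + 2 : ℕ) - 1)).toNat = d + 1 + 1 by omega,
      show ((n : ℤ) - (n + 1 - (d + 2 : ℕ))).toNat = d + 1 by omega,
      show ((n : ℤ) - (n + 1 - (d + 2 : ℕ) + 1)).toNat = d by omega]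
    simp only [coeff_X_mul]

/-- The linear functional on `R[X]` with `m`-th moment `pgf x y m k`. -/
noncomputable def pgfFunctional (x y : R) (k : ℤ) : R[X] →ₗ[R] R :=
  Polynomial.lsum fun m => LinearMap.mulRight R (pgf x y m k)

theorem pgfFunctional_monomial (x y : R) (k : ℤ) (m : ℕ) (a : R) :
    pgfFunctional x y k (monomial m a) = a * pgf x y m k := by
  exact sum_monomial_index _ _ (zero_mul _)

theorem pgfFunctional_one (x y : R) (k : ℤ) :
    pgfFunctional x y k 1 = if k = 0 then 1 else 0 := by
  rw [← monomial_zero_one, pgfFunctional_monomial, one_mul, pgf_zero]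

theorem pgfFunctional_X_sub_C_mul (x y : R) (k : ℤ) (f : R[X]) :
    pgfFunctional x y k ((X - C (x + y)) * f) =
      pgfFunctional x y (k - 1) f + x * y * pgfFunctional x y (k + 1) f := by
  induction f using Polynomial.induction_on' with
  | add f g hf hg => rw [mul_add, map_add _ (_ * f), map_add _ f g, map_add _ f g, hf, hg]; ring
  | monomial m a =>
    rw [sub_mul, X_mul_monomial, C_mul_monomial, map_sub]
    simp only [pgfFunctional_monomial, pgf_succ]
    ring

/-- The Dickson polynomial of the first kind with parameter `x * y`, shifted by `x + y`. -/
noncomputable def shiftedDickson (x y : R) (i : ℕ) : R[X] :=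
  (dickson 1 (x * y) i).comp (X - C (x + y))

theorem shiftedDickson_zero (x y : R) : shiftedDickson x y 0 = 2 := by
  simp only [shiftedDickson, dickson_zero]
  norm_num

theorem shiftedDickson_one (x y : R) : shiftedDickson x y 1 = X - C (x + y) := by
  simp [shiftedDickson]

theorem shiftedDickson_add_two (x y : R) (i : ℕ) :
    shiftedDickson x y (i + 2) =
      (X - C (x + y)) * shiftedDickson x y (i + 1) - C (x * y) * shiftedDickson x y i := by
  simp [shiftedDickson]

theorem pgfFunctional_shiftedDickson_mul (x y : R) (i : ℕ) (k : ℤ) (f : R[X]) :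
    pgfFunctional x y k (shiftedDickson x y i * f) =
      pgfFunctional x y (k - i) f + (x * y) ^ i * pgfFunctional x y (k + i) f := by
  induction i using Nat.twoStepInduction generalizing k with
  | zero => simp [shiftedDickson_zero, two_mul]
  | one =>
    simpa only [shiftedDickson_one, pow_one, Nat.cast_one] using
      pgfFunctional_X_sub_C_mul x y k f
  | more i ih1 ih2 =>
    rw [shiftedDickson_add_two, sub_mul, mul_assoc, mul_assoc, map_sub,
      pgfFunctional_X_sub_C_mul, ← smul_eq_C_mul, map_smul, ih1, ih2, ih2, smul_eq_mul,
      show k - 1 - ((i + 1 : ℕ) : ℤ) = k - (i + 2 : ℕ) by push_cast; ring,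
      show k + 1 + ((i + 1 : ℕ) : ℤ) = k + (i + 2 : ℕ) by push_cast; ring,
      show k - 1 + ((i + 1 : ℕ) : ℤ) = k + i by push_cast; ring,
      show k + 1 - ((i + 1 : ℕ) : ℤ) = k - i by push_cast; ring]
    ring

theorem isMonicOfDegree_shiftedDickson [Nontrivial R] (x y : R) (i : ℕ) :
    IsMonicOfDegree (shiftedDickson x y (i + 1)) (i + 1) := by
  induction i using Nat.twoStepInduction with
  | zero => simpa [shiftedDickson_one] using isMonicOfDegree_X_sub_one (x + y)
  | one =>
    rw [shiftedDickson_add_two, shiftedDickson_one, shiftedDickson_zero]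
    refine ((isMonicOfDegree_X_sub_one (x + y)).mul (isMonicOfDegree_X_sub_one (x + y))).sub ?_
    rw [← C_ofNat, ← C_mul, natDegree_C]
    exact Nat.zero_lt_two
  | more i ih1 ih2 =>
    rw [shiftedDickson_add_two, show i + 2 + 1 = 1 + (i + 1 + 1) by ring]
    refine ((isMonicOfDegree_X_sub_one (x + y)).mul ih2).sub ?_
    refine (natDegree_C_mul_le _ _).trans_lt ?_
    rw [ih1.natDegree_eq]
    omega

/-- Hankel determinants do not change when the monomials are replaced by another family of
monic polynomials. -/
theorem det_pgf_eq_det_pgfFunctional (x y : R) (k : ℤ) (n : ℕ) (Q : ℕ → R[X])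
    (hdeg : ∀ i, (Q i).natDegree = i) (hmonic : ∀ i, (Q i).Monic) :
    (Matrix.of fun i j : Fin n => pgf x y (i.1 + j.1) k).det =
      (Matrix.of fun i j : Fin n => pgfFunctional x y k (Q i * Q j)).det := by
  set B : Matrix (Fin n) (Fin n) R := Matrix.of fun i j : Fin n => (Q j).coeff i with hB
  have hdet : B.det = 1 :=
    Matrix.det_matrixOfPolynomials (fun j : Fin n => Q j) (fun j => hdeg j) fun j => hmonic j
  have hQ (j : Fin n) : Q j = ∑ a : Fin n, monomial a.1 (B a j) := by
    rw [(Q j).as_sum_range' n (by rw [hdeg]; exact j.2), Finset.sum_range]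
    rfl
  suffices h : (Matrix.of fun i j : Fin n => pgfFunctional x y k (Q i * Q j)) =
      B.transpose * (Matrix.of fun i j : Fin n => pgf x y (i.1 + j.1) k) * B by
    rw [h, Matrix.det_mul, Matrix.det_mul, Matrix.det_transpose, hdet, one_mul, mul_one]
  ext i j
  simp only [Matrix.of_apply, Matrix.mul_apply, Matrix.transpose_apply]
  rw [hQ i, hQ j]
  simp only [Finset.sum_mul, Finset.mul_sum, map_sum, monomial_mul_monomial,
    pgfFunctional_monomial]
  exact Finset.sum_congr rfl fun a _ => Finset.sum_congr rfl fun b _ => by ring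

/-- The matrix to which the Hankel matrix of the `pgf x y m k` reduces when `0 < k`. -/
def foldedBandMatrix (p : R) (k n : ℕ) : Matrix (Fin n) (Fin n) R :=
  Matrix.of fun i j =>
    if i.1 + j.1 = k then 1 else if i.1 = j.1 + k then p ^ j.1
    else if j.1 = i.1 + k then p ^ i.1 else 0

/-- `1` followed by the shifted Dickson polynomials of positive degree. -/
noncomputable def monicDickson (x y : R) (i : ℕ) : R[X] :=
  if i = 0 then 1 else shiftedDickson x y i

theorem isMonicOfDegree_monicDickson [Nontrivial R] (x y : R) (i : ℕ) :
    IsMonicOfDegree (monicDickson x y i) i := by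
  cases i with
  | zero => simp [monicDickson]
  | succ i => simpa [monicDickson] using isMonicOfDegree_shiftedDickson x y i

theorem pgfFunctional_shiftedDickson (x y : R) (i : ℕ) (k : ℤ) :
    pgfFunctional x y k (shiftedDickson x y i) =
      (if k = i then 1 else 0) + (x * y) ^ i * if k = -i then 1 else 0 := by
  have h := pgfFunctional_shiftedDickson_mul x y i k 1
  simpa only [mul_one, pgfFunctional_one, sub_eq_zero, add_eq_zero_iff_eq_neg] using h

theorem det_pgf_eq_det_foldedBandMatrix [Nontrivial R] (x y : R) (k n : ℕ) (hk : 0 < k) :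
    (Matrix.of fun i j : Fin n => pgf x y (i.1 + j.1) (k : ℤ)).det =
      (foldedBandMatrix (x * y) k n).det := by
  rw [det_pgf_eq_det_pgfFunctional x y k n (monicDickson x y)
    (fun i => (isMonicOfDegree_monicDickson x y i).natDegree_eq)
    (fun i => (isMonicOfDegree_monicDickson x y i).monic)]
  congr 1
  ext ⟨i, hi⟩ ⟨j, hj⟩
  simp only [Matrix.of_apply, foldedBandMatrix, monicDickson]
  rcases Nat.eq_zero_or_pos i with rfl | hi0
  · rcases Nat.eq_zero_or_pos j with rfl | hj0
    · simp [pgfFunctional_one, hk.ne, hk.ne']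
    · rw [if_pos rfl, if_neg hj0.ne', one_mul, pgfFunctional_shiftedDickson,
        if_neg (show ¬ (k : ℤ) = -j by omega)]
      split_ifs <;> first | omega | simp
  · rcases Nat.eq_zero_or_pos j with rfl | hj0
    · rw [if_pos rfl, if_neg hi0.ne', mul_one, pgfFunctional_shiftedDickson,
        if_neg (show ¬ (k : ℤ) = -i by omega)]
      split_ifs <;> first | omega | simp
    · rw [if_neg hi0.ne', if_neg hj0.ne', pgfFunctional_shiftedDickson_mul,
        pgfFunctional_shiftedDickson, pgfFunctional_shiftedDickson]
      split_ifs <;> first | omega | simp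

theorem det_pgf_zero [Nontrivial R] (x y : R) (n : ℕ) :
    (Matrix.of fun i j : Fin n => pgf x y (i.1 + j.1) 0).det =
      2 ^ (n - 1) * (x * y) ^ n.choose 2 := by
  rw [det_pgf_eq_det_pgfFunctional x y 0 n (monicDickson x y)
    (fun i => (isMonicOfDegree_monicDickson x y i).natDegree_eq)
    (fun i => (isMonicOfDegree_monicDickson x y i).monic)]
  have h : (Matrix.of fun i j : Fin n => pgfFunctional x y 0 (monicDickson x y i *
      monicDickson x y j)) =
      Matrix.diagonal fun i : Fin n => if i.1 = 0 then 1 else 2 * (x * y) ^ i.1 := by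
    ext ⟨i, hi⟩ ⟨j, hj⟩
    simp only [Matrix.of_apply, Matrix.diagonal_apply, monicDickson, Fin.mk.injEq]
    rcases Nat.eq_zero_or_pos i with rfl | hi0
    · rcases Nat.eq_zero_or_pos j with rfl | hj0
      · simp [pgfFunctional_one]
      · rw [if_pos rfl, if_neg hj0.ne', one_mul, pgfFunctional_shiftedDickson]
        split_ifs <;> first | omega | simp
    · rcases Nat.eq_zero_or_pos j with rfl | hj0
      · rw [if_pos rfl, if_neg hi0.ne', mul_one, pgfFunctional_shiftedDickson]
        split_ifs <;> first | omega | simp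
      · rw [if_neg hi0.ne', if_neg hj0.ne', pgfFunctional_shiftedDickson_mul,
          pgfFunctional_shiftedDickson, pgfFunctional_shiftedDickson]
        split_ifs <;> first | omega | (subst_vars; ring)
  rw [h, Matrix.det_diagonal, Fin.prod_univ_eq_prod_range
    (fun i => if i = 0 then (1 : R) else 2 * (x * y) ^ i)]
  cases n with
  | zero => simp
  | succ n =>
    rw [Finset.prod_range_succ']
    simp only [Nat.add_eq_zero_iff, one_ne_zero, and_false, if_false, if_true, mul_one,
      Finset.prod_mul_distrib, Finset.prod_const, Finset.card_range, add_tsub_cancel_right,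
      Finset.prod_pow_eq_pow_sum]
    rw [Nat.choose_two_right, ← Finset.sum_range_id, Finset.sum_range_succ', add_zero]

end Functional

section FoldedBandMatrix

variable {R : Type*} [CommRing R]

theorem Matrix.det_fromBlocks_zero_neg_one_one_zero (β : Type*) [Fintype β] [DecidableEq β] :
    (Matrix.fromBlocks 0 (-1) 1 0 : Matrix (β ⊕ β) (β ⊕ β) R).det = 1 := by
  have h : (Matrix.fromBlocks 0 (-1) 1 0 : Matrix (β ⊕ β) (β ⊕ β) R) =
      Matrix.fromBlocks 1 (-1) 0 1 * Matrix.fromBlocks 1 0 1 1 * Matrix.fromBlocks 1 (-1) 0 1 := by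
    simp [Matrix.fromBlocks_multiply]
  rw [h, Matrix.det_mul, Matrix.det_mul, Matrix.det_fromBlocks_zero₂₁,
    Matrix.det_fromBlocks_zero₁₂]
  simp

theorem Matrix.det_fromBlocks_bordered {α β : Type*} [Fintype α] [DecidableEq α] [Fintype β]
    [DecidableEq β] (A : Matrix α α R) (U : Matrix α β R) (V : Matrix β α R)
    (E D D' : Matrix β β R) :
    (Matrix.fromBlocks A (Matrix.fromCols U 0) (Matrix.fromRows V 0)
      (Matrix.fromBlocks E D D' 0)).det =
      (-1) ^ Fintype.card β * A.det * D.det * D'.det := by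
  have h : Matrix.fromBlocks A (Matrix.fromCols U 0) (Matrix.fromRows V 0)
      (Matrix.fromBlocks E D D' 0) *
      Matrix.fromBlocks (1 : Matrix α α R) 0 0 (Matrix.fromBlocks 0 (-1) 1 0) =
      (Matrix.fromBlocks (Matrix.fromBlocks A 0 V D)
        (Matrix.fromRows (-U) (-E)) 0 (-D')).submatrix
        (Equiv.sumAssoc α β β).symm (Equiv.sumAssoc α β β).symm := by
    simp only [Matrix.fromBlocks_multiply]
    ext (i | i | i) (j | j | j) <;>
      simp [Matrix.mul_apply, Fintype.sum_sum_type, Matrix.one_apply]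
  have h' := congrArg Matrix.det h
  rw [Matrix.det_mul, Matrix.det_fromBlocks_zero₂₁, Matrix.det_one, one_mul,
    Matrix.det_fromBlocks_zero_neg_one_one_zero, mul_one, Matrix.det_submatrix_equiv_self,
    Matrix.det_fromBlocks_zero₂₁, Matrix.det_fromBlocks_zero₁₂, Matrix.det_neg] at h'
  rw [h']
  ring

theorem det_foldedBandMatrix_add_two_mul (p : R) (k m : ℕ) (hk : 0 < k) :
    (foldedBandMatrix p k (m + 2 * k)).det =
      (-1) ^ k * p ^ (k * (2 * m + k - 1)) * (foldedBandMatrix p k m).det := by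
  let e : Fin m ⊕ (Fin k ⊕ Fin k) ≃ Fin (m + 2 * k) :=
    ((Equiv.refl _).sumCongr finSumFinEquiv).trans
      (finSumFinEquiv.trans (finCongr (by rw [two_mul])))
  have he1 (a : Fin m) : (e (Sum.inl a)).1 = a.1 := by simp [e]
  have he2 (b : Fin k) : (e (Sum.inr (Sum.inl b))).1 = m + b.1 := by simp [e]
  have he3 (b : Fin k) : (e (Sum.inr (Sum.inr b))).1 = m + (k + b.1) := by simp [e, add_comm]
  let N := (foldedBandMatrix p k (m + 2 * k)).submatrix e e
  let D : Matrix (Fin k) (Fin k) R := Matrix.diagonal fun b => p ^ (m + b.1)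
  have h : N = Matrix.fromBlocks (foldedBandMatrix p k m)
      (Matrix.fromCols (Matrix.of fun a b => N (Sum.inl a) (Sum.inr (Sum.inl b))) 0)
      (Matrix.fromRows (Matrix.of fun b a => N (Sum.inr (Sum.inl b)) (Sum.inl a)) 0)
      (Matrix.fromBlocks (Matrix.of fun b c => N (Sum.inr (Sum.inl b)) (Sum.inr (Sum.inl c)))
        D D 0) := by
    ext (i | i | i) (j | j | j)
    · simp [N, foldedBandMatrix, he1]
    · simp
    · have := i.2
      simp only [N, foldedBandMatrix, Matrix.submatrix_apply, Matrix.of_apply, he1, he3,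
        Matrix.fromBlocks_apply₁₂, Matrix.fromCols_apply_inr, Matrix.zero_apply]
      rw [if_neg (by omega), if_neg (by omega), if_neg (by omega)]
    · simp
    · simp
    · simp only [N, D, foldedBandMatrix, Matrix.submatrix_apply, Matrix.of_apply, he2, he3,
        Matrix.fromBlocks_apply₂₂, Matrix.fromBlocks_apply₁₂, Matrix.diagonal_apply, Fin.ext_iff]
      split_ifs <;> first
        | rfl
        | omega
        | (rw [show m + i.1 = 0 by omega, pow_zero])
    · have := j.2
      simp only [N, foldedBandMatrix, Matrix.submatrix_apply, Matrix.of_apply, he1, he3,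
        Matrix.fromBlocks_apply₂₁, Matrix.fromRows_apply_inr, Matrix.zero_apply]
      rw [if_neg (by omega), if_neg (by omega), if_neg (by omega)]
    · simp only [N, D, foldedBandMatrix, Matrix.submatrix_apply, Matrix.of_apply, he2, he3,
        Matrix.fromBlocks_apply₂₂, Matrix.fromBlocks_apply₂₁, Matrix.diagonal_apply, Fin.ext_iff]
      split_ifs <;> first
        | rfl
        | omega
        | (rw [show m + i.1 = 0 by omega, pow_zero])
        | (congr 1; omega)
    · have := j.2
      have := i.2
      simp only [N, foldedBandMatrix, Matrix.submatrix_apply, Matrix.of_apply, he3,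
        Matrix.fromBlocks_apply₂₂, Matrix.zero_apply]
      rw [if_neg (by omega), if_neg (by omega), if_neg (by omega)]
  have hD : D.det * D.det = p ^ (k * (2 * m + k - 1)) := by
    rw [Matrix.det_diagonal, Fin.prod_univ_eq_prod_range (fun b => p ^ (m + b)),
      Finset.prod_pow_eq_pow_sum, ← pow_add, ← mul_two, Finset.sum_add_distrib, add_mul,
      Finset.sum_range_id_mul_two, Finset.sum_const, Finset.card_range, smul_eq_mul,
      Nat.add_sub_assoc hk]
    ring
  rw [← Matrix.det_submatrix_equiv_self e, ← hD]
  change N.det = _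
  rw [h, Matrix.det_fromBlocks_bordered, Fintype.card_fin]
  ring

theorem Matrix.det_antidiagonal (n : ℕ) :
    (Matrix.of fun i j : Fin n => if i.1 + j.1 + 1 = n then (1 : R) else 0).det =
      (-1) ^ n.choose 2 := by
  induction n with
  | zero => simp
  | succ n ih =>
    rw [Matrix.det_succ_row_zero, Finset.sum_eq_single (Fin.last n)]
    · rw [Nat.choose_succ_succ' n 1, Nat.choose_one_right, pow_add, ← ih]
      simp only [Matrix.of_apply, Fin.val_last, Fin.val_zero, zero_add, if_true, mul_one]
      congr 2
      ext i j
      simp only [Matrix.submatrix_apply, Matrix.of_apply, Fin.succAbove_last, Fin.val_succ,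
        Fin.val_castSucc]
      congr 1
      exact propext (by omega)
    · intro j _ hj
      have : j.1 ≠ n := fun h => hj (Fin.ext h)
      simp [this]
    · simp

theorem det_foldedBandMatrix_self_add_one (p : R) (k : ℕ) :
    (foldedBandMatrix p k (k + 1)).det = (-1) ^ (k + 1).choose 2 := by
  rw [← Matrix.det_antidiagonal]
  congr 1
  ext i j
  simp only [foldedBandMatrix, Matrix.of_apply]
  split_ifs <;> first | rfl | omega

theorem det_foldedBandMatrix_eq_zero_of_le (p : R) (k n : ℕ) (hn : 0 < n) (hnk : n ≤ k) :
    (foldedBandMatrix p k n).det = 0 := by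
  refine Matrix.det_eq_zero_of_row_eq_zero ⟨0, hn⟩ fun j => ?_
  simp only [foldedBandMatrix, Matrix.of_apply]
  rw [if_neg (by omega), if_neg (by omega), if_neg (by omega)]

theorem det_foldedBandMatrix_eq_zero_of_lt_of_lt (p : R) (k n : ℕ) (hkn : k + 1 < n)
    (hnk : n < 2 * k) : (foldedBandMatrix p k n).det = 0 := by
  have h := Matrix.det_updateRow_add_smul_self (foldedBandMatrix p k n)
    (i := ⟨k + 1, hkn⟩) (j := ⟨k - 1, by omega⟩) (by simp [Fin.ext_iff]; omega) (-p)
  rw [← h]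
  refine Matrix.det_eq_zero_of_row_eq_zero ⟨k + 1, hkn⟩ fun j => ?_
  rw [Matrix.updateRow_self]
  simp only [foldedBandMatrix, Matrix.of_apply, Pi.add_apply, Pi.smul_apply, smul_eq_mul]
  rw [if_neg (by omega), if_neg (show ¬ j.1 = k + 1 + k by omega),
    if_neg (show ¬ k - 1 = j.1 + k by omega), if_neg (show ¬ j.1 = k - 1 + k by omega)]
  by_cases hj : j.1 = 1
  · rw [if_pos (by omega), if_pos (by omega), hj]
    ring
  · rw [if_neg (by omega), if_neg (by omega)]
    ring

theorem det_foldedBandMatrix_two_mul_mul (p : R) (k r : ℕ) (hk : 0 < k) :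
    (foldedBandMatrix p k (2 * k * r)).det =
      (-1) ^ (k * r) * p ^ (k * r * (2 * k * r - k - 1)) := by
  induction r with
  | zero => simp
  | succ r ih =>
    rw [mul_add_one (2 * k), det_foldedBandMatrix_add_two_mul _ _ _ hk, ih]
    rw [show (-1 : R) ^ k * p ^ (k * (2 * (2 * k * r) + k - 1)) *
        ((-1) ^ (k * r) * p ^ (k * r * (2 * k * r - k - 1))) =
      (-1) ^ (k + k * r) *
        p ^ (k * (2 * (2 * k * r) + k - 1) + k * r * (2 * k * r - k - 1)) by ring]
    congr 2
    · ring
    · rcases r with _ | r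
      · simp; omega
      · obtain ⟨k, rfl⟩ := Nat.exists_eq_add_of_lt hk
        have h1 : 2 * (2 * (0 + k + 1) * (r + 1)) + (0 + k + 1) - 1 =
            4 * (k + 1) * (r + 1) + k := by
          rw [Nat.sub_eq_of_eq_add]; ring
        have h2 : 2 * (0 + k + 1) * (r + 1) - (0 + k + 1) - 1 = 2 * (k + 1) * r + k := by
          rw [Nat.sub_sub, Nat.sub_eq_of_eq_add]; ring
        have h3 : 2 * (0 + k + 1) * (r + 1) + 2 * (0 + k + 1) - (0 + k + 1) - 1 =
            2 * (k + 1) * (r + 1) + k := by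
          rw [Nat.sub_sub, Nat.sub_eq_of_eq_add]; ring
        rw [h1, h2, h3]
        ring

theorem det_foldedBandMatrix_two_mul_mul_add (p : R) (k r : ℕ) (hk : 0 < k) :
    (foldedBandMatrix p k (2 * k * r + (k + 1))).det =
      (-1) ^ (k * (r + 1) + k.choose 2) * p ^ (k * r * (2 * k * r + k + 1)) := by
  induction r with
  | zero =>
    rw [mul_zero, zero_add, det_foldedBandMatrix_self_add_one, Nat.choose_succ_succ' k 1,
      Nat.choose_one_right]
    simp
  | succ r ih =>
    rw [show 2 * k * (r + 1) + (k + 1) = 2 * k * r + (k + 1) + 2 * k by ring,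
      det_foldedBandMatrix_add_two_mul _ _ _ hk, ih,
      show 2 * (2 * k * r + (k + 1)) + k - 1 = 4 * k * r + 3 * k + 1 by
        rw [Nat.sub_eq_of_eq_add]; ring]
    ring

theorem det_foldedBandMatrix_eq_zero (p : R) (k n : ℕ) (hk : 0 < k) (h0 : n % (2 * k) ≠ 0)
    (h1 : n % (2 * k) ≠ (k + 1) % (2 * k)) : (foldedBandMatrix p k n).det = 0 := by
  induction n using Nat.strong_induction_on with
  | _ n ih =>
    rcases Nat.lt_or_ge n (2 * k) with hn | hn
    · rw [Nat.mod_eq_of_lt hn] at h0 h1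
      rcases Nat.lt_or_ge k n with hkn | hkn
      · rw [Nat.mod_eq_of_lt (by omega)] at h1
        exact det_foldedBandMatrix_eq_zero_of_lt_of_lt p k n (by omega) hn
      · exact det_foldedBandMatrix_eq_zero_of_le p k n (by omega) hkn
    · obtain ⟨m, rfl⟩ := Nat.exists_eq_add_of_le' hn
      rw [Nat.add_mod_right] at h0 h1
      rw [det_foldedBandMatrix_add_two_mul p k m hk, ih m (by omega) h0 h1, mul_zero]

end FoldedBandMatrix

/-- Theorem 3: evaluation of `det_{0≤i,j≤n−1}(P_{i+j}(0,k))`.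
The hypotheses `n = 2kn₁−k+1` and `n = 2kn₁` are stated additively as
`n + k = 2kn₁ + 1` and `n = 2kn₁` to avoid truncated subtraction. -/
theorem det_hankel_pgf {R : Type*} [CommRing R] (x y : R) (n : ℕ) (hn : 0 < n) :
    (∀ k : ℕ, 0 < k →
      (∀ n₁ : ℕ, 0 < n₁ → n + k = 2 * k * n₁ + 1 →
        Matrix.det (Matrix.of fun i j : Fin n => pgf x y (i.1 + j.1) (k : ℤ)) =
          (-1 : R) ^ (k * n₁ + Nat.choose k 2) *
            (x * y) ^ (k * (n₁ - 1) * (2 * k * n₁ - k + 1))) ∧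
      (∀ n₁ : ℕ, 0 < n₁ → n = 2 * k * n₁ →
        Matrix.det (Matrix.of fun i j : Fin n => pgf x y (i.1 + j.1) (k : ℤ)) =
          (-1 : R) ^ (k * n₁) * (x * y) ^ (k * n₁ * (2 * k * n₁ - k - 1))) ∧
      (n % (2 * k) ≠ 0 ∧ n % (2 * k) ≠ (k + 1) % (2 * k) →
        Matrix.det (Matrix.of fun i j : Fin n => pgf x y (i.1 + j.1) (k : ℤ)) = 0)) ∧
    Matrix.det (Matrix.of fun i j : Fin n => pgf x y (i.1 + j.1) (0 : ℤ)) =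
      2 ^ (n - 1) * (x * y) ^ Nat.choose n 2 := by
  nontriviality R
  refine ⟨fun k hk => ?_, det_pgf_zero x y n⟩
  rw [det_pgf_eq_det_foldedBandMatrix x y k n hk]
  refine ⟨fun r hr hnr => ?_, fun r _ hnr => ?_, fun h => ?_⟩
  · obtain ⟨r, rfl⟩ := Nat.exists_eq_add_one.2 hr
    obtain rfl : n = 2 * k * r + (k + 1) := by
      rw [mul_add_one] at hnr
      omega
    rw [det_foldedBandMatrix_two_mul_mul_add _ _ _ hk, Nat.add_sub_cancel,
      show 2 * k * (r + 1) - k = 2 * k * r + k by rw [mul_add_one]; omega]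
  · rw [hnr, det_foldedBandMatrix_two_mul_mul _ _ _ hk]
  · exact det_foldedBandMatrix_eq_zero _ _ _ hk h.1 h.2
end

section
/- Let R be a commutative ring, x, y, t ∈ R, and n a positive integer. For every nonnegative integer k, the n×n determinant det_{0≤i,j≤n−1}(P_j(i,k) − t·(xy)^{i+1}·P_j(−i−2,k)) equals (−1)^{n₁·C(k+1,2)}·t^{k⌊n₁/2⌋}·(xy)^{(k+1)²·C(n₁,2)} if n = n₁(k+1) for a positive integer n₁, and equals 0 if k+1 does not divide n. Moreover, for k = −1, det_{0≤i,j≤n−1}(P_j(i,−1) − t·(xy)^{i+1}·P_j(−i−2,−1)) = 0. -/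
/-- The matrix of Theorem 8, with `(i,j)`-entry
`P_j(i,k) − t·(xy)^{i+1}·P_j(−i−2,k) = pgf x y j (k−i) − t·(xy)^{i+1}·pgf x y j (k+i+2)`. -/
def thm8Matrix {R : Type*} [CommRing R] (x y t : R) (n : ℕ) (k : ℤ) :
    Matrix (Fin n) (Fin n) R :=
  Matrix.of fun i j =>
    pgf x y j.1 (k - i.1) - t * (x * y) ^ (i.1 + 1) * pgf x y j.1 (k + i.1 + 2)

section PathPolynomials

variable {R : Type*} [CommRing R] (x y : R)

lemma pgf_eq_zero_of_lt {n : ℕ} {k : ℤ} (h : (n : ℤ) < k) : pgf x y n k = 0 := by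
  unfold pgf
  refine Finset.sum_eq_zero fun l _ => if_neg ?_
  omega

lemma pgf_self (n : ℕ) : pgf x y n n = 1 := by
  unfold pgf
  rw [Finset.sum_eq_single 0]
  · simp
  · intro l _ hl
    refine if_neg ?_
    omega
  · simp

lemma pgf_natCast {n m d : ℕ} (h : n = m + d) :
    pgf x y n m = ∑ l ∈ Finset.range (d + 1),
      (n.choose l : R) * (n.choose (d - l) : R) * x ^ l * y ^ (d - l) := by
  unfold pgf
  have hs : Finset.range (d + 1) ⊆ Finset.range (n + 1) :=
    Finset.range_subset_range.2 (by omega)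
  rw [← Finset.sum_subset hs]
  · refine Finset.sum_congr rfl fun l hl => ?_
    have hl' := Finset.mem_range.1 hl
    rw [if_pos (by omega), show ((n : ℤ) - m - l).toNat = d - l by omega]
  · intro l _ hl
    rw [Finset.mem_range] at hl
    exact if_neg (by omega)

lemma pgf_neg (n m : ℕ) : pgf x y n (-(m : ℤ)) = (x * y) ^ m * pgf x y n m := by
  rcases lt_or_ge n m with h | h
  · rw [pgf_eq_zero_of_lt x y (k := (m : ℤ)) (by exact_mod_cast h), mul_zero]
    unfold pgf
    refine Finset.sum_eq_zero fun l hl => ?_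
    rw [Finset.mem_range] at hl
    rw [Nat.choose_eq_zero_of_lt (show n < ((n : ℤ) - -(m : ℤ) - l).toNat by omega)]
    simp
  · obtain ⟨d, rfl⟩ := Nat.exists_eq_add_of_le h
    rw [pgf_natCast x y rfl]
    unfold pgf
    rw [show m + d + 1 = m + (d + 1) by ring, Finset.sum_range_add,
      Finset.sum_eq_zero, zero_add, Finset.mul_sum]
    · refine Finset.sum_congr rfl fun l hl => ?_
      have hl' : l ≤ d := Nat.lt_succ_iff.1 (Finset.mem_range.1 hl)
      rw [if_pos (by push_cast; omega),
        show (((m + d : ℕ) : ℤ) - -(m : ℤ) - ((m + l : ℕ) : ℤ)).toNat = m + (d - l) by omega,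
        ← Nat.choose_symm (show m + l ≤ m + d by omega),
        ← Nat.choose_symm (show m + (d - l) ≤ m + d by omega),
        show m + d - (m + l) = d - l by omega, show m + d - (m + (d - l)) = l by omega]
      ring
    · intro l hl
      rw [Finset.mem_range] at hl
      rw [Nat.choose_eq_zero_of_lt
        (show m + d < (((m + d : ℕ) : ℤ) - -(m : ℤ) - l).toNat by omega)]
      simp

end PathPolynomials

section SparseMatrix

variable {R : Type*} [CommRing R]

/-- The matrix obtained from `thm8Matrix x y t n (K - 1)`, with `q = x * y`, by expanding its
columns in the Laurent polynomials `1` and `z ^ j + (q / z) ^ j`, `j ≥ 1`. -/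
def sparseMatrix (q t : R) (n K : ℕ) : Matrix (Fin n) (Fin n) R :=
  Matrix.of fun i j =>
    (if (j : ℕ) + K = i + 1 ∨ (i : ℕ) + 1 + j = K then q ^ ((i : ℕ) + 1 - K) else 0) -
      if (j : ℕ) = i + 1 + K then t * q ^ ((i : ℕ) + 1) else 0

lemma sum_ite_val_eq_mul_pgf (x y c : R) {n j : ℕ} (hj : j < n) (p : ℕ → Prop)
    [DecidablePred p] (d : ℕ) (hp : ∀ m, p m ↔ m = d) :
    ∑ m : Fin n, (if p m then c else 0) * pgf x y j (m : ℕ) = c * pgf x y j (d : ℕ) := by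
  simp only [hp]
  rcases lt_or_ge d n with hd | hd
  · rw [Finset.sum_eq_single ⟨d, hd⟩]
    · simp
    · intro m _ hm
      rw [if_neg (fun h => hm (Fin.ext h)), zero_mul]
    · simp
  · rw [pgf_eq_zero_of_lt x y (by omega), mul_zero]
    refine Finset.sum_eq_zero fun m _ => ?_
    rw [if_neg (by omega), zero_mul]

lemma thm8Matrix_eq_sparseMatrix_mul (x y t : R) (n K : ℕ) :
    thm8Matrix x y t n ((K : ℤ) - 1) =
      sparseMatrix (x * y) t n K * Matrix.of fun m j : Fin n => pgf x y j.1 (m.1 : ℤ) := by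
  ext i j
  simp only [thm8Matrix, sparseMatrix, Matrix.mul_apply, Matrix.of_apply, sub_mul,
    Finset.sum_sub_distrib]
  congr 1
  · rcases le_or_gt (i.1 + 1) K with h | h
    · rw [sum_ite_val_eq_mul_pgf x y _ j.2 (fun m => m + K = i.1 + 1 ∨ i.1 + 1 + m = K)
        (K - (i.1 + 1)) (fun m => by omega), Nat.sub_eq_zero_of_le h, pow_zero, one_mul]
      congr 1
      omega
    · rw [sum_ite_val_eq_mul_pgf x y _ j.2 (fun m => m + K = i.1 + 1 ∨ i.1 + 1 + m = K)
        (i.1 + 1 - K) (fun m => by omega), ← pgf_neg]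
      congr 1
      omega
  · rw [sum_ite_val_eq_mul_pgf x y _ j.2 (fun m => m = i.1 + 1 + K) (i.1 + 1 + K)
      (fun m => Iff.rfl)]
    congr 2
    push_cast
    ring

lemma det_thm8Matrix_eq_det_sparseMatrix (x y t : R) (n K : ℕ) :
    (thm8Matrix x y t n ((K : ℤ) - 1)).det = (sparseMatrix (x * y) t n K).det := by
  rw [thm8Matrix_eq_sparseMatrix_mul, Matrix.det_mul, Matrix.det_of_isUpperTriangular (M := Matrix.of fun m j : Fin n => pgf x y j.1 (m.1 : ℤ))]
  · simp [pgf_self]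
  · intro i j hij
    have hij' : (j : ℕ) < i := hij
    exact pgf_eq_zero_of_lt x y (by exact_mod_cast hij')

lemma det_sparseMatrix_eq_zero_of_lt (q t : R) {n K : ℕ} (hn : 0 < n) (h : n < K) :
    (sparseMatrix q t n K).det = 0 := by
  refine Matrix.det_eq_zero_of_column_eq_zero ⟨0, hn⟩ fun i => ?_
  simp only [sparseMatrix, Matrix.of_apply]
  rw [if_neg (by omega), if_neg (by omega), sub_zero]

lemma det_sparseMatrix_eq_zero_of_lt_of_lt (q t : R) {n K : ℕ} (h : K < n) (h' : n < 2 * K) :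
    (sparseMatrix q t n K).det = 0 := by
  refine Matrix.det_eq_zero_of_column_eq_zero ⟨K, h⟩ fun i => ?_
  simp only [sparseMatrix, Matrix.of_apply]
  rw [if_neg (by omega), if_neg (by omega), sub_zero]

lemma det_sparseMatrix_zero_right (q t : R) {n : ℕ} (hn : 0 < n) :
    (sparseMatrix q t n 0).det = 0 := by
  refine Matrix.det_eq_zero_of_column_eq_zero ⟨0, hn⟩ fun i => ?_
  simp only [sparseMatrix, Matrix.of_apply]
  rw [if_neg (by omega), if_neg (by omega), sub_zero]

lemma det_antidiagonal_one (K : ℕ) :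
    (Matrix.of fun i j : Fin K => if (i : ℕ) + 1 + j = K then (1 : R) else 0).det =
      (-1) ^ K.choose 2 := by
  induction K with
  | zero => simp
  | succ K ih =>
    rw [Matrix.det_succ_row_zero, Finset.sum_eq_single (Fin.last K)]
    · have : ((Matrix.of fun i j : Fin (K + 1) =>
          if (i : ℕ) + 1 + j = K + 1 then (1 : R) else 0).submatrix Fin.succ
            (Fin.last K).succAbove) =
          Matrix.of fun i j : Fin K => if (i : ℕ) + 1 + j = K then (1 : R) else 0 := by
        ext i j
        simp only [Matrix.submatrix_apply, Matrix.of_apply, Fin.succAbove_last, Fin.val_succ,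
          Fin.val_castSucc]
        exact if_congr (by omega) rfl rfl
      rw [this, ih, Nat.choose_succ_succ' K 1, Nat.choose_one_right, pow_add]
      simp [add_comm]
    · intro j _ hj
      have hj' : (j : ℕ) ≠ K := fun h => hj (Fin.ext h)
      simp only [Matrix.of_apply]
      rw [if_neg (by rw [Fin.val_zero]; omega)]
      simp
    · simp

lemma det_sparseMatrix_self (q t : R) (K : ℕ) :
    (sparseMatrix q t K K).det = (-1) ^ K.choose 2 := by
  rw [← det_antidiagonal_one]
  congr 1
  ext i j
  simp only [sparseMatrix, Matrix.of_apply]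
  rw [if_neg (show ¬ (j : ℕ) = i + 1 + K by omega), sub_zero]
  refine if_congr (by omega) ?_ rfl
  rw [Nat.sub_eq_zero_of_le (by omega), pow_zero]

lemma coe_finRotate_pow_apply (m p : ℕ) (i : Fin (m + 1)) :
    (((finRotate (m + 1)) ^ p) i : ℕ) = (i + p) % (m + 1) := by
  induction p with
  | zero => simp [Nat.mod_eq_of_lt i.2]
  | succ p ih =>
    rw [pow_succ', Equiv.Perm.mul_apply, finRotate_apply, Fin.val_add, ih]
    rw [Fin.val_one', ← Nat.add_mod, add_assoc]

lemma Matrix.BlockTriangular.det_congr {m α : Type*} [Fintype m] [DecidableEq m] [LinearOrder α]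
    {M N : Matrix m m R} {b : m → α} (hM : M.BlockTriangular b) (hN : N.BlockTriangular b)
    (h : ∀ i j, b i = b j → M i j = N i j) : M.det = N.det := by
  rw [hM.det, hN.det]
  refine Finset.prod_congr rfl fun a _ => ?_
  congr 1
  ext i j
  exact h _ _ (i.2.trans j.2.symm)

lemma prod_range_neg_mul_pow_mul_prod_range_pow (q t : R) (n p : ℕ) :
    (∏ i ∈ Finset.range p, -(t * q ^ (n + i + 1))) * ∏ i ∈ Finset.range (p + 2), q ^ (n + i) =
      (-t) ^ p * q ^ (2 * (p + 1) * n + (p + 1) ^ 2) := by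
  induction p with
  | zero => simp [Finset.prod_range_succ]; ring
  | succ p ih =>
    rw [Finset.prod_range_succ, Finset.prod_range_succ _ (p + 2), mul_mul_mul_comm, ih]
    ring

lemma det_sparseMatrix_add (q t : R) (n p : ℕ) :
    (sparseMatrix q t (n + (2 * p + 1 + 1)) (p + 1)).det =
      t ^ p * q ^ (2 * (p + 1) * n + (p + 1) ^ 2) * (sparseMatrix q t n (p + 1)).det := by
  set σ : Equiv.Perm (Fin n ⊕ Fin (2 * p + 1 + 1)) :=
    Equiv.Perm.sumCongr 1 (finRotate (2 * p + 1 + 1) ^ (p + 2)) with hσ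
  have hsign : (Equiv.Perm.sign σ : ℤ) = (-1) ^ p := by
    rw [hσ, Equiv.Perm.sign_sumCongr, map_pow, sign_finRotate, map_one, one_mul]
    simp [pow_add, pow_mul]
  set M := (sparseMatrix q t (n + (2 * p + 1 + 1)) (p + 1)).submatrix finSumFinEquiv
    finSumFinEquiv with hM
  have hdet : (sparseMatrix q t (n + (2 * p + 1 + 1)) (p + 1)).det =
      (-1) ^ p * (M.submatrix id σ).det := by
    rw [Matrix.det_permute', hsign, hM, Matrix.det_submatrix_equiv_self]
    push_cast
    rw [← mul_assoc, ← mul_pow]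
    simp
  set d : ℕ → R := fun i => if i < p then -(t * q ^ (n + i + 1)) else q ^ (n + (i - p)) with hd
  set N : Matrix (Fin n ⊕ Fin (2 * p + 1 + 1)) (Fin n ⊕ Fin (2 * p + 1 + 1)) R :=
    Matrix.fromBlocks (sparseMatrix q t n (p + 1)) 0 0 (Matrix.diagonal fun i => d i) with hN
  have hσ' : ∀ i : Fin (2 * p + 1 + 1), i.1 < p ∧
      ((finRotate (2 * p + 1 + 1) ^ (p + 2)) i : ℕ) = i + p + 2 ∨ p ≤ i.1 ∧
      ((finRotate (2 * p + 1 + 1) ^ (p + 2)) i : ℕ) + p = i := by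
    intro i
    rw [coe_finRotate_pow_apply]
    rcases lt_or_ge i.1 p with h | h
    · left
      rw [Nat.mod_eq_of_lt (by omega)]
      omega
    · right
      rw [Nat.mod_eq_sub_mod (by omega), Nat.mod_eq_of_lt (by omega)]
      omega
  set b : Fin n ⊕ Fin (2 * p + 1 + 1) → ℕ :=
    Sum.elim (fun _ => 1) (fun i => if i.1 < p then 0 else 2) with hb
  have key : (M.submatrix id σ).det = N.det := by
    refine Matrix.BlockTriangular.det_congr (b := b) ?_ ?_ ?_
    · rintro (i | i) (j | j) hij
      · simp [hb] at hij
      · rcases hσ' j with ⟨hj, hσj⟩ | ⟨hj, hσj⟩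
        · simp only [hM, hσ, sparseMatrix, Matrix.submatrix_apply, Matrix.of_apply, id_eq,
            Equiv.Perm.sumCongr_apply, Sum.map_inr, finSumFinEquiv_apply_left,
            finSumFinEquiv_apply_right, Fin.val_castAdd, Fin.val_natAdd, hσj]
          rw [if_neg (by omega), if_neg (by omega), sub_zero]
        · simp [hb, hj.not_gt] at hij
      · rcases lt_or_ge i.1 p with hi | hi
        · simp [hb, hi] at hij
        · simp only [hM, hσ, sparseMatrix, Matrix.submatrix_apply, Matrix.of_apply, id_eq,
            Equiv.Perm.sumCongr_apply, Sum.map_inl, finSumFinEquiv_apply_left,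
            finSumFinEquiv_apply_right, Fin.val_castAdd, Fin.val_natAdd, Equiv.Perm.one_apply]
          rw [if_neg (by omega), if_neg (by omega), sub_zero]
      · rcases hσ' j with ⟨hj, hσj⟩ | ⟨hj, hσj⟩
        · rcases lt_or_ge i.1 p with hi | hi
          · simp [hb, hi] at hij
          · simp only [hM, hσ, sparseMatrix, Matrix.submatrix_apply, Matrix.of_apply, id_eq,
              Equiv.Perm.sumCongr_apply, Sum.map_inr, finSumFinEquiv_apply_right,
              Fin.val_natAdd, hσj]
            rw [if_neg (by omega), if_neg (by omega), sub_zero]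
        · simp only [hb, Sum.elim_inr, if_neg hj.not_gt] at hij
          split_ifs at hij <;> omega
    · rintro (i | i) (j | j) hij
      · simp [hb] at hij
      · simp [hN]
      · simp [hN]
      · rw [hN, Matrix.fromBlocks_apply₂₂, Matrix.diagonal_apply_ne]
        rintro rfl
        exact lt_irrefl _ hij
    · rintro (i | i) (j | j) hij
      · simp [hM, hN, hσ, sparseMatrix]
      · simp only [hb, Sum.elim_inr, Sum.elim_inl] at hij
        split_ifs at hij
        omega
      · simp only [hb, Sum.elim_inr, Sum.elim_inl] at hij
        split_ifs at hij
        omega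
      · simp only [hM, hN, hσ, hd, sparseMatrix, Matrix.submatrix_apply, Matrix.of_apply, id_eq,
          Equiv.Perm.sumCongr_apply, Sum.map_inr, finSumFinEquiv_apply_right,
          Matrix.fromBlocks_apply₂₂, Matrix.diagonal_apply, Fin.val_natAdd, Fin.ext_iff]
        simp only [hb, Sum.elim_inr] at hij
        rcases hσ' j with ⟨hj, hσj⟩ | ⟨hj, hσj⟩
        · have hi : i.1 < p := by
            by_contra hi
            simp [hj, hi] at hij
          rw [if_neg (by omega), zero_sub, if_pos hi, ← add_assoc]
          by_cases h : i.1 = j.1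
          · rw [if_pos (by omega), if_pos h]
          · rw [if_neg (by omega), if_neg h, neg_zero]
        · have hi : ¬ i.1 < p := by
            intro hi
            simp [hj.not_gt, hi] at hij
          rw [if_neg (show ¬ n + _ = _ by omega), sub_zero, if_neg hi,
            show n + i.1 + 1 - (p + 1) = n + (i.1 - p) by omega]
          exact if_congr (by omega) rfl rfl
  have hNdet : N.det = (sparseMatrix q t n (p + 1)).det *
      ((-t) ^ p * q ^ (2 * (p + 1) * n + (p + 1) ^ 2)) := by
    rw [hN, Matrix.det_fromBlocks_zero₂₁, Matrix.det_diagonal, Fin.prod_univ_eq_prod_range,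
      ← prod_range_neg_mul_pow_mul_prod_range_pow, show 2 * p + 1 + 1 = p + (p + 2) by ring,
      Finset.prod_range_add]
    congr 2
    · exact Finset.prod_congr rfl fun i hi => if_pos (Finset.mem_range.1 hi)
    · refine Finset.prod_congr rfl fun i hi => ?_
      simp [hd]
  rw [hdet, key, hNdet]
  have h1 : ((-1 : R) ^ p) * (-t) ^ p = t ^ p := by rw [← mul_pow]; simp
  linear_combination (sparseMatrix q t n (p + 1)).det * q ^ (2 * (p + 1) * n + (p + 1) ^ 2) * h1

lemma det_sparseMatrix_mul (q t : R) (p m : ℕ) :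
    (sparseMatrix q t (m * (p + 1)) (p + 1)).det =
      (-1) ^ (m * (p + 1).choose 2) * t ^ (p * (m / 2)) * q ^ ((p + 1) ^ 2 * m.choose 2) := by
  induction m using Nat.twoStepInduction with
  | zero =>
    have : IsEmpty (Fin (0 * (p + 1))) := by rw [zero_mul]; infer_instance
    simp
  | one =>
    rw [one_mul, det_sparseMatrix_self]
    simp
  | more m ih _ =>
    have hc : (m + 2).choose 2 = m.choose 2 + 2 * m + 1 := by
      simp [Nat.choose_succ_succ' _ 1]
      ring
    rw [show (m + 2) * (p + 1) = m * (p + 1) + (2 * p + 1 + 1) by ring, det_sparseMatrix_add, ih,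
      hc, Nat.add_div_right m two_pos, add_mul m 2, pow_add (-1 : R),
      pow_mul (-1 : R) 2, neg_one_sq, one_pow]
    ring

lemma det_sparseMatrix_eq_zero_of_not_dvd (q t : R) {p n : ℕ} (h : ¬ (p + 1) ∣ n) :
    (sparseMatrix q t n (p + 1)).det = 0 := by
  induction n using Nat.strong_induction_on with
  | _ n ih =>
    rcases lt_or_ge n (2 * (p + 1)) with hn | hn
    · have h0 : n ≠ 0 := fun h0 => h (h0 ▸ dvd_zero _)
      have h1 : n ≠ p + 1 := fun h1 => h (h1 ▸ dvd_rfl)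
      rcases lt_or_gt_of_ne h1 with h2 | h2
      · exact det_sparseMatrix_eq_zero_of_lt q t (Nat.pos_of_ne_zero h0) h2
      · exact det_sparseMatrix_eq_zero_of_lt_of_lt q t h2 hn
    · obtain ⟨m, rfl⟩ := Nat.exists_eq_add_of_le' hn
      rw [show m + 2 * (p + 1) = m + (2 * p + 1 + 1) by ring, det_sparseMatrix_add,
        ih m (by omega) (fun hm => h (hm.add (Dvd.intro_left 2 rfl))), mul_zero]

end SparseMatrix

/-- Theorem 8: for nonnegative `k`, `det_{0≤i,j≤n−1}(P_j(i,k) − t(xy)^{i+1}P_j(−i−2,k))`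
equals `(−1)^{n₁C(k+1,2)}·t^{k⌊n₁/2⌋}·(xy)^{(k+1)²C(n₁,2)}` if `n = n₁(k+1)`, `n₁ ≥ 1`,
and `0` if `k+1 ∤ n`; moreover the analogous determinant for `k = −1` vanishes. -/
theorem det_thm8Matrix {R : Type*} [CommRing R] (x y t : R) (n : ℕ) (hn : 0 < n) :
    (∀ k : ℕ,
      (∀ n₁ : ℕ, 0 < n₁ → n = n₁ * (k + 1) →
        (thm8Matrix x y t n (k : ℤ)).det =
          (-1 : R) ^ (n₁ * Nat.choose (k + 1) 2) * t ^ (k * (n₁ / 2)) *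
            (x * y) ^ ((k + 1) ^ 2 * Nat.choose n₁ 2)) ∧
      (¬ (k + 1) ∣ n → (thm8Matrix x y t n (k : ℤ)).det = 0)) ∧
    (thm8Matrix x y t n (-1 : ℤ)).det = 0 := by
  refine ⟨fun k => ?_, ?_⟩
  · have hk : (k : ℤ) = ((k + 1 : ℕ) : ℤ) - 1 := by push_cast; ring
    rw [hk, det_thm8Matrix_eq_det_sparseMatrix]
    refine ⟨?_, det_sparseMatrix_eq_zero_of_not_dvd _ _⟩
    rintro m - rfl
    exact det_sparseMatrix_mul _ _ _ _
  · rw [show (-1 : ℤ) = ((0 : ℕ) : ℤ) - 1 by norm_num, det_thm8Matrix_eq_det_sparseMatrix]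
    exact det_sparseMatrix_zero_right _ _ hn
end
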